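/- Let n ≥ 4 and 1 ≤ p ≤ n − 3. Among all connected simple graphs on n vertices with exactly p pendant vertices, the maximum of the sigma index σ is attained by a graph whose maximum degree equals n − 1; that is, there exists a connected graph G on n vertices with exactly p pendant vertices and Δ(G) = n − 1 such that σ(H) ≤ σ(G) for every connected graph H on n vertices with exactly p pendant vertices. -/

import Mathlib

open Finset

variable {V : Type*}

noncomputable def sigmaIndex [Fintype V] (G : SimpleGraph V) : ℤ := by
  classical
  exact ∑ e ∈ G.edgeFinset,
    Sym2.lift ⟨fun u v => ((G.degree u : ℤ) - (G.degree v : ℤ)) ^ 2, fun u v => by ring⟩ e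

noncomputable def deg [Fintype V] (G : SimpleGraph V) (v : V) : ℕ := by
  classical
  exact G.degree v

noncomputable def nbrCount [Fintype V] (G : SimpleGraph V) (v : V) (P : V → Prop) : ℕ := by
  classical
  exact ((G.neighborFinset v).filter P).card

def IsCaterpillar [Fintype V] (G : SimpleGraph V) : Prop :=
  ∃ (u w : V) (P : G.Walk u w), P.IsPath ∧
    ∀ x : V, x ∈ P.support ∨ ∃ y ∈ P.support, G.Adj x y

/-- The number of pendant (degree-one) vertices of `G`. -/
noncomputable def pendantCount [Fintype V] (G : SimpleGraph V) : ℕ := by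
  classical
  exact (Finset.univ.filter (fun w => G.degree w = 1)).card

/-- The maximum degree of `G`. -/
noncomputable def maxDeg [Fintype V] (G : SimpleGraph V) : ℕ := by
  classical
  exact G.maxDegree

open Classical Matrix

/-- The sum of the degrees of the neighbours of `v`. -/
noncomputable def nbrDegSum [Fintype V] (G : SimpleGraph V) (v : V) : ℤ :=
  ∑ u ∈ G.neighborFinset v, (G.degree u : ℤ)

section

variable {G G' : SimpleGraph V} {v w x : V} {T : Finset V}

theorem connected_of_adj_reachable (hG : G.Connected)
    (h : ∀ y z, G.Adj y z → G'.Reachable y z) : G'.Connected := by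
  have := hG.nonempty
  refine ⟨fun y z => ?_⟩
  obtain ⟨p⟩ := hG.preconnected y z
  induction p with
  | nil => rfl
  | cons hadj _ ih => exact (h _ _ hadj).trans ih

/-- The graph `G` with the edge `vx` added. -/
def addEdge (G : SimpleGraph V) (v x : V) : SimpleGraph V :=
  G ⊔ SimpleGraph.edge v x

theorem addEdge_adj (hne : v ≠ x) {y z : V} :
    (addEdge G v x).Adj y z ↔ G.Adj y z ∨ (y = v ∧ z = x) ∨ (y = x ∧ z = v) := by
  rw [addEdge, SimpleGraph.sup_adj, SimpleGraph.edge_adj]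
  grind

theorem adjMatrix_addEdge (hne : v ≠ x) (hvx : ¬ G.Adj v x) :
    (addEdge G v x).adjMatrix ℤ = G.adjMatrix ℤ
      + vecMulVec (Pi.single v 1) (Pi.single x 1) + vecMulVec (Pi.single x 1) (Pi.single v 1) := by
  ext y z
  have hxv : ¬ G.Adj x v := fun h => hvx h.symm
  simp only [SimpleGraph.adjMatrix_apply, Matrix.add_apply, vecMulVec_apply, Pi.single_apply,
    addEdge_adj hne]
  by_cases h1 : y = v <;> by_cases h2 : z = x <;> by_cases h3 : y = x <;> by_cases h4 : z = v <;>
    simp_all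

/-- The graph obtained from `G` by replacing the edges from `w` to `T` by edges from `v` to `T`. -/
def shiftEdges (G : SimpleGraph V) (v w : V) (T : Finset V) : SimpleGraph V :=
  SimpleGraph.fromRel fun y z =>
    (G.Adj y z ∧ ¬ (y = w ∧ z ∈ T) ∧ ¬ (z = w ∧ y ∈ T)) ∨ (y = v ∧ z ∈ T)

theorem shiftEdges_adj (hT : ∀ y ∈ T, G.Adj w y ∧ ¬ G.Adj v y ∧ y ≠ v) {y z : V} :
    (shiftEdges G v w T).Adj y z ↔ (G.Adj y z ∧ ¬ (y = w ∧ z ∈ T) ∧ ¬ (z = w ∧ y ∈ T)) ∨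
      (y = v ∧ z ∈ T) ∨ (z = v ∧ y ∈ T) := by
  have hv : v ∉ T := fun h => (hT v h).2.2 rfl
  rw [shiftEdges, SimpleGraph.fromRel_adj, G.adj_comm z y]
  constructor
  · tauto
  · intro h
    refine ⟨?_, by tauto⟩
    rintro rfl
    rcases h with h | ⟨rfl, h⟩ | ⟨rfl, h⟩
    · exact G.irrefl h.1
    · exact hv h
    · exact hv h

theorem adjMatrix_shiftEdges (hvw : v ≠ w) (hT : ∀ y ∈ T, G.Adj w y ∧ ¬ G.Adj v y ∧ y ≠ v) :
    (shiftEdges G v w T).adjMatrix ℤ = G.adjMatrix ℤ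
      + vecMulVec (Pi.single v 1 - Pi.single w 1) (fun y => if y ∈ T then 1 else 0)
      + vecMulVec (fun y => if y ∈ T then 1 else 0) (Pi.single v 1 - Pi.single w 1) := by
  ext y z
  have hv : v ∉ T := fun h => (hT v h).2.2 rfl
  have hw : w ∉ T := fun h => G.irrefl (hT w h).1
  simp only [SimpleGraph.adjMatrix_apply, Matrix.add_apply, vecMulVec_apply, Pi.single_apply,
    Pi.sub_apply, shiftEdges_adj hT]
  by_cases hy : y ∈ T <;> by_cases hz : z ∈ T
  · have h1 : y ≠ v := fun h => hv (h ▸ hy)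
    have h2 : y ≠ w := fun h => hw (h ▸ hy)
    have h3 : z ≠ v := fun h => hv (h ▸ hz)
    have h4 : z ≠ w := fun h => hw (h ▸ hz)
    simp [*]
  · have h1 : y ≠ v := fun h => hv (h ▸ hy)
    have h2 : y ≠ w := fun h => hw (h ▸ hy)
    have h3 := hT y hy
    by_cases h4 : z = v
    · subst h4; simp [*, G.adj_comm y z]
    · by_cases h5 : z = w
      · subst h5; simp [*, h3.1.symm]
      · simp [*]
  · have h1 : z ≠ v := fun h => hv (h ▸ hz)
    have h2 : z ≠ w := fun h => hw (h ▸ hz)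
    have h3 := hT z hz
    by_cases h4 : y = v
    · subst h4; simp [*]
    · by_cases h5 : y = w
      · subst h5; simp [*]
      · simp [*]
  · simp [*]

theorem connected_addEdge (hG : G.Connected) (hne : v ≠ x) : (addEdge G v x).Connected :=
  connected_of_adj_reachable hG fun _ _ h => ((addEdge_adj hne).2 (Or.inl h)).reachable

theorem connected_shiftEdges (hG : G.Connected)
    (hT : ∀ y ∈ T, G.Adj w y ∧ ¬ G.Adj v y ∧ y ≠ v)
    (hk : ∃ k, G.Adj w k ∧ (k = v ∨ G.Adj v k)) : (shiftEdges G v w T).Connected := by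
  have hw : w ∉ T := fun h => G.irrefl (hT w h).1
  have hv : v ∉ T := fun h => (hT v h).2.2 rfl
  obtain ⟨k, hwk, hk⟩ := hk
  have hkT : k ∉ T := fun h => hk.elim (hT k h).2.2 (hT k h).2.1
  have hwk' : (shiftEdges G v w T).Adj w k := (shiftEdges_adj hT).2 (Or.inl (by tauto))
  have hwv : (shiftEdges G v w T).Reachable w v := by
    rcases hk with rfl | hk
    · exact hwk'.reachable
    · exact hwk'.reachable.trans ((shiftEdges_adj hT).2
        (Or.inl ⟨hk.symm, fun h => hv h.2, fun h => hkT h.2⟩)).reachable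
  have key : ∀ y ∈ T, (shiftEdges G v w T).Reachable w y := fun y hy =>
    hwv.trans ((shiftEdges_adj hT).2 (Or.inr (Or.inl ⟨rfl, hy⟩))).reachable
  refine connected_of_adj_reachable hG fun y z h => ?_
  by_cases h1 : y = w ∧ z ∈ T
  · obtain ⟨rfl, h1⟩ := h1
    exact key z h1
  by_cases h2 : z = w ∧ y ∈ T
  · obtain ⟨rfl, h2⟩ := h2
    exact (key y h2).symm
  · exact ((shiftEdges_adj hT).2 (Or.inl ⟨h, h1, h2⟩)).reachable

theorem adj_ite_nonneg (G : SimpleGraph V) (v w : V) : (0 : ℤ) ≤ if G.Adj v w then 1 else 0 := by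
  split_ifs <;> norm_num

end

section

variable [Fintype V] {G G' : SimpleGraph V} {v w x : V} {T : Finset V}

theorem sum_darts_eq (G : SimpleGraph V) (F : V → V → ℤ) :
    ∑ d : G.Dart, F d.fst d.snd = ∑ v, ∑ u ∈ G.neighborFinset v, F v u := by
  rw [← Finset.sum_fiberwise (s := univ) (g := fun d : G.Dart => d.fst)]
  refine Finset.sum_congr rfl fun v _ => ?_
  rw [G.dart_fst_fiber v, Finset.sum_image (fun a _ b _ h => G.dartOfNeighborSet_injective v h)]
  rw [← Finset.sum_coe_sort (G.neighborFinset v)]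
  refine Fintype.sum_equiv (Equiv.subtypeEquivRight fun u => by simp) _ _ fun u => rfl

theorem two_mul_sum_edges (G : SimpleGraph V) (F : Sym2 V → ℤ) :
    2 * ∑ e ∈ G.edgeFinset, F e = ∑ v, ∑ u ∈ G.neighborFinset v, F s(v, u) := by
  rw [← sum_darts_eq G fun v u => F s(v, u)]
  rw [← Finset.sum_fiberwise_of_maps_to (s := univ) (t := G.edgeFinset)
    (g := fun d : G.Dart => d.edge) (fun d _ => by simp [SimpleGraph.mem_edgeFinset, d.edge_mem]),
    Finset.mul_sum]
  refine Finset.sum_congr rfl fun e he => ?_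
  rw [Finset.sum_congr rfl (g := fun _ => F e)]
  · rw [Finset.sum_const, G.dart_edge_fiber_card e (by simpa using he)]
    simp
  · intro d hd
    rw [← (Finset.mem_filter.mp hd).2]
    rfl

theorem sum_sum_neighbor_comm (G : SimpleGraph V) (F : V → V → ℤ) :
    ∑ v, ∑ u ∈ G.neighborFinset v, F v u = ∑ u, ∑ v ∈ G.neighborFinset u, F v u :=
  Finset.sum_comm' (by simp [G.adj_comm])

theorem sigmaIndex_eq (G : SimpleGraph V) :
    sigmaIndex G = ∑ v, (G.degree v : ℤ) ^ 3 - ∑ v, (G.degree v : ℤ) * nbrDegSum G v := by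
  have h1 := two_mul_sum_edges G (Sym2.lift
    ⟨fun u v => ((G.degree u : ℤ) - (G.degree v : ℤ)) ^ 2, fun u v => by ring⟩)
  have h2 : ∑ v, ∑ u ∈ G.neighborFinset v, (G.degree v : ℤ) ^ 2 = ∑ v, (G.degree v : ℤ) ^ 3 := by
    refine Finset.sum_congr rfl fun v _ => ?_
    rw [Finset.sum_const, G.card_neighborFinset_eq_degree, nsmul_eq_mul]
    ring
  have h3 := sum_sum_neighbor_comm G fun v _ => (G.degree v : ℤ) ^ 2
  have h4 : ∑ v, (G.degree v : ℤ) * nbrDegSum G v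
      = ∑ v, ∑ u ∈ G.neighborFinset v, (G.degree v : ℤ) * G.degree u :=
    Finset.sum_congr rfl fun v _ => Finset.mul_sum ..
  have h5 : 2 * sigmaIndex G = ∑ v, ∑ u ∈ G.neighborFinset v,
      ((G.degree v : ℤ) - G.degree u) ^ 2 := h1
  simp only [sub_sq, Finset.sum_add_distrib, Finset.sum_sub_distrib, mul_assoc,
    ← Finset.mul_sum] at h5 h2 h3 h4
  linarith

theorem nbrDegSum_eq_mulVec (G : SimpleGraph V) :
    nbrDegSum G = G.adjMatrix ℤ *ᵥ fun v => (G.degree v : ℤ) := by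
  ext v
  rw [SimpleGraph.adjMatrix_mulVec_apply, nbrDegSum]

theorem degree_eq_mulVec (G : SimpleGraph V) :
    (fun v => (G.degree v : ℤ)) = G.adjMatrix ℤ *ᵥ 1 := by
  ext v
  simp [SimpleGraph.adjMatrix_mulVec_apply]

theorem sigmaIndex_eq_dotProduct (G : SimpleGraph V) :
    sigmaIndex G = ∑ v, (G.degree v : ℤ) ^ 3 - (fun v => (G.degree v : ℤ)) ⬝ᵥ nbrDegSum G :=
  sigmaIndex_eq G

theorem dotProduct_adjMatrix_mulVec_comm (G : SimpleGraph V) (a b : V → ℤ) :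
    a ⬝ᵥ (G.adjMatrix ℤ *ᵥ b) = b ⬝ᵥ (G.adjMatrix ℤ *ᵥ a) := by
  rw [dotProduct_mulVec, ← mulVec_transpose, G.transpose_adjMatrix, dotProduct_comm]

/-- The degrees of a graph obtained by a symmetric rank-two change of the adjacency matrix. -/
theorem degree_of_adjMatrix_eq {f g : V → ℤ}
    (h : G'.adjMatrix ℤ = G.adjMatrix ℤ + vecMulVec f g + vecMulVec g f) :
    (fun y => (G'.degree y : ℤ)) =
      (fun y => (G.degree y : ℤ)) + ((g ⬝ᵥ 1) • f + (f ⬝ᵥ 1) • g) := by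
  rw [degree_eq_mulVec, degree_eq_mulVec, h, add_mulVec, add_mulVec, vecMulVec_mulVec,
    vecMulVec_mulVec, add_assoc]
  simp

/-- The change of `∑ v, d v * ∑ u ∈ N v, d u` under a symmetric rank-two change of the adjacency
matrix. -/
theorem dotProduct_nbrDegSum_of_adjMatrix_eq {f g e : V → ℤ}
    (h : G'.adjMatrix ℤ = G.adjMatrix ℤ + vecMulVec f g + vecMulVec g f)
    (he : (fun y => (G'.degree y : ℤ)) = (fun y => (G.degree y : ℤ)) + e) :
    (fun y => (G'.degree y : ℤ)) ⬝ᵥ nbrDegSum G' =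
      (fun y => (G.degree y : ℤ)) ⬝ᵥ nbrDegSum G + 2 * (e ⬝ᵥ nbrDegSum G)
        + e ⬝ᵥ (G.adjMatrix ℤ *ᵥ e)
        + 2 * (f ⬝ᵥ fun y => (G'.degree y : ℤ)) * (g ⬝ᵥ fun y => (G'.degree y : ℤ)) := by
  have h1 : (fun y => (G'.degree y : ℤ)) ⬝ᵥ nbrDegSum G' =
      (fun y => (G'.degree y : ℤ)) ⬝ᵥ (G.adjMatrix ℤ *ᵥ fun y => (G'.degree y : ℤ))
        + 2 * (f ⬝ᵥ fun y => (G'.degree y : ℤ)) * (g ⬝ᵥ fun y => (G'.degree y : ℤ)) := by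
    rw [nbrDegSum_eq_mulVec, h, add_mulVec, add_mulVec, vecMulVec_mulVec,
      vecMulVec_mulVec, dotProduct_add, dotProduct_add]
    simp only [op_smul_eq_smul, dotProduct_smul, smul_eq_mul]
    rw [dotProduct_comm _ f, dotProduct_comm _ g]
    ring
  rw [h1, nbrDegSum_eq_mulVec, he, mulVec_add, add_dotProduct, dotProduct_add, dotProduct_add,
    dotProduct_adjMatrix_mulVec_comm G (fun y => (G.degree y : ℤ)) e]
  ring

theorem sum_degree_cube_sub (hvw : v ≠ w)
    (h : ∀ y, y ≠ v → y ≠ w → G'.degree y = G.degree y) :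
    ∑ y, (G'.degree y : ℤ) ^ 3 - ∑ y, (G.degree y : ℤ) ^ 3 =
      ((G'.degree v : ℤ) ^ 3 - (G.degree v : ℤ) ^ 3)
        + ((G'.degree w : ℤ) ^ 3 - (G.degree w : ℤ) ^ 3) := by
  rw [← Finset.sum_sub_distrib]
  exact Fintype.sum_eq_add v w hvw fun y hy => by rw [h y hy.1 hy.2, sub_self]

theorem degree_addEdge (hne : v ≠ x) (hvx : ¬ G.Adj v x) (y : V) :
    ((addEdge G v x).degree y : ℤ) =
      G.degree y + ((Pi.single v 1 : V → ℤ) y + (Pi.single x 1 : V → ℤ) y) := by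
  have := congrFun (degree_of_adjMatrix_eq (adjMatrix_addEdge hne hvx)) y
  simpa using this

theorem sigmaIndex_addEdge (hne : v ≠ x) (hvx : ¬ G.Adj v x) :
    sigmaIndex (addEdge G v x) = sigmaIndex G
      + (3 * (G.degree v : ℤ) ^ 2 + 3 * (G.degree x : ℤ) ^ 2 + G.degree v + G.degree x
        - 2 * G.degree v * G.degree x - 2 * nbrDegSum G v - 2 * nbrDegSum G x) := by
  have hd := degree_addEdge hne hvx
  have h3 := sum_degree_cube_sub (G := G) (G' := addEdge G v x) hne fun y h1 h2 => by
    have := hd y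
    simp only [Pi.single_apply, h1, h2, if_false] at this
    exact_mod_cast (by linarith : ((addEdge G v x).degree y : ℤ) = G.degree y)
  have hq := dotProduct_nbrDegSum_of_adjMatrix_eq (adjMatrix_addEdge hne hvx)
    (e := Pi.single v 1 + Pi.single x 1) (funext hd)
  have hxv : ¬ G.Adj x v := fun h => hvx h.symm
  rw [sigmaIndex_eq_dotProduct, sigmaIndex_eq_dotProduct, hq]
  simp only [mulVec_add, add_dotProduct, dotProduct_add, single_one_dotProduct,
    mulVec_single_one, col_apply, SimpleGraph.adjMatrix_apply, hvx, hxv, G.irrefl, hd,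
    Pi.single_apply, hne, hne.symm, if_true, if_false] at h3 ⊢
  linear_combination h3

theorem degree_shiftEdges (hvw : v ≠ w) (hT : ∀ y ∈ T, G.Adj w y ∧ ¬ G.Adj v y ∧ y ≠ v) (y : V) :
    ((shiftEdges G v w T).degree y : ℤ) =
      G.degree y + #T * ((Pi.single v 1 : V → ℤ) y - (Pi.single w 1 : V → ℤ) y) := by
  have := congrFun (degree_of_adjMatrix_eq (adjMatrix_shiftEdges hvw hT)) y
  simpa [dotProduct, sub_dotProduct] using this

theorem sigmaIndex_shiftEdges (hvw : v ≠ w)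
    (hT : ∀ y ∈ T, G.Adj w y ∧ ¬ G.Adj v y ∧ y ≠ v) :
    sigmaIndex (shiftEdges G v w T) = sigmaIndex G
      + (3 * (G.degree v + G.degree w) * #T * (G.degree v - G.degree w + #T)
        - 2 * #T * (nbrDegSum G v - nbrDegSum G w)
        + 2 * (#T : ℤ) ^ 2 * (if G.Adj v w then 1 else 0)
        - 2 * (G.degree v - G.degree w + 2 * #T) * ∑ y ∈ T, (G.degree y : ℤ)) := by
  have hd := degree_shiftEdges hvw hT
  have h3 := sum_degree_cube_sub (G := G) (G' := shiftEdges G v w T) hvw fun y h1 h2 => by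
    have := hd y
    simp only [Pi.single_apply, h1, h2, if_false] at this
    exact_mod_cast (by linarith : ((shiftEdges G v w T).degree y : ℤ) = G.degree y)
  have hq := dotProduct_nbrDegSum_of_adjMatrix_eq (adjMatrix_shiftEdges hvw hT)
    (e := (#T : ℤ) • (Pi.single v 1 - Pi.single w 1)) (funext hd)
  have hS : ((fun y => if y ∈ T then 1 else 0 : V → ℤ) ⬝ᵥ
      fun y => ((shiftEdges G v w T).degree y : ℤ)) = ∑ y ∈ T, (G.degree y : ℤ) := by
    simp only [dotProduct, ite_mul, one_mul, zero_mul, Finset.sum_ite_mem, Finset.univ_inter]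
    refine Finset.sum_congr rfl fun y hy => ?_
    have h1 : y ≠ v := (hT y hy).2.2
    have h2 : y ≠ w := (hT y hy).1.ne'
    simp [hd, h1, h2]
  rw [sigmaIndex_eq_dotProduct, sigmaIndex_eq_dotProduct, hq, hS]
  simp only [mulVec_smul, smul_dotProduct, dotProduct_smul, smul_eq_mul, mulVec_sub,
    sub_dotProduct, dotProduct_sub, single_one_dotProduct,
    mulVec_single_one, col_apply, SimpleGraph.adjMatrix_apply, G.irrefl, hd, G.adj_comm w v,
    Pi.single_apply, hvw, hvw.symm, if_true, if_false] at h3 ⊢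
  linear_combination h3

/-- `G'` is connected with as many pendant vertices as `G`, a larger maximum degree and a sigma
index that is at least as large. -/
def ImprovedBy (G G' : SimpleGraph V) : Prop :=
  G'.Connected ∧ pendantCount G' = pendantCount G ∧ maxDeg G < maxDeg G' ∧
    sigmaIndex G ≤ sigmaIndex G'

theorem improvedBy_of_degree (hG' : G'.Connected) (hmax : ∀ y, G.degree y ≤ G.degree v)
    (hpend : ∀ y, G'.degree y = 1 ↔ G.degree y = 1) (hlt : G.degree v < G'.degree v)
    (hσ : sigmaIndex G ≤ sigmaIndex G') : ImprovedBy G G' := by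
  refine ⟨hG', ?_, ?_, hσ⟩
  · simp only [pendantCount, hpend]
  · exact (G.maxDegree_le_of_forall_degree_le _ hmax).trans_lt
      (hlt.trans_le (G'.degree_le_maxDegree v))

theorem sum_degree_le {s : Finset V} {δ : ℕ} (h : ∀ y ∈ s, G.degree y ≤ δ) :
    ∑ y ∈ s, (G.degree y : ℤ) ≤ #s * δ := by
  exact_mod_cast Finset.sum_le_card_nsmul s _ δ h

theorem nbrDegSum_le (hmax : ∀ y, G.degree y ≤ G.degree v) (x : V) :
    nbrDegSum G x ≤ G.degree x * G.degree v := by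
  simpa [nbrDegSum] using sum_degree_le (s := G.neighborFinset x) fun u _ => hmax u

theorem improvedBy_addEdge (hG : G.Connected) (hmax : ∀ y, G.degree y ≤ G.degree v)
    (hne : v ≠ x) (hvx : ¬ G.Adj v x) (hx : 2 ≤ G.degree x)
    (hS : 2 * nbrDegSum G x ≤ (G.degree v : ℤ) ^ 2 + 3 * (G.degree x : ℤ) ^ 2 + G.degree v
      + G.degree x - 2 * G.degree v * G.degree x) :
    ImprovedBy G (addEdge G v x) := by
  have hd := degree_addEdge hne hvx
  have hdv : ((addEdge G v x).degree v : ℤ) = G.degree v + 1 := by simp [hd, hne]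
  have hdx : ((addEdge G v x).degree x : ℤ) = G.degree x + 1 := by simp [hd, hne.symm]
  have hv2 := hmax x
  refine improvedBy_of_degree (v := v) (connected_addEdge hG hne) hmax (fun y => ?_) (by omega) ?_
  · by_cases h1 : y = v
    · subst h1; omega
    by_cases h2 : y = x
    · subst h2; omega
    have := hd y
    simp only [Pi.single_apply, h1, h2, if_false] at this
    omega
  · rw [sigmaIndex_addEdge hne hvx]
    nlinarith [nbrDegSum_le hmax v]

theorem improvedBy_shiftEdges (hG : G.Connected) (hmax : ∀ y, G.degree y ≤ G.degree v)
    (hvw : v ≠ w) (hT : ∀ y ∈ T, G.Adj w y ∧ ¬ G.Adj v y ∧ y ≠ v) (hTne : T.Nonempty)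
    (hk : ∃ k, G.Adj w k ∧ (k = v ∨ G.Adj v k)) (hcard : #T + 2 ≤ G.degree w)
    (hσ : sigmaIndex G ≤ sigmaIndex (shiftEdges G v w T)) :
    ImprovedBy G (shiftEdges G v w T) := by
  have hd := degree_shiftEdges hvw hT
  have hdv : ((shiftEdges G v w T).degree v : ℤ) = G.degree v + #T := by simp [hd, hvw]
  have hdw : ((shiftEdges G v w T).degree w : ℤ) = G.degree w - #T := by
    simp [hd, hvw.symm]; ring
  have hpos := hTne.card_pos
  have hwv := hmax w
  refine improvedBy_of_degree (v := v) (connected_shiftEdges hG hT hk) hmax (fun y => ?_)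
    (by omega) hσ
  by_cases h1 : y = v
  · subst h1; omega
  by_cases h2 : y = w
  · subst h2; omega
  have := hd y
  simp only [Pi.single_apply, h1, h2, if_false] at this
  omega

/-- The neighbours of `v` outside the closed neighbourhood of `w`. -/
noncomputable def privateNeighbors (G : SimpleGraph V) (v w : V) : Finset V :=
  (G.neighborFinset v).filter fun y => ¬ G.Adj w y ∧ y ≠ w

theorem mem_privateNeighbors {y : V} :
    y ∈ privateNeighbors G v w ↔ G.Adj v y ∧ ¬ G.Adj w y ∧ y ≠ w := by
  simp [privateNeighbors]

theorem sum_neighborFinset_eq (F : V → ℤ) (v w : V) :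
    ∑ y ∈ G.neighborFinset v, F y = ∑ y ∈ privateNeighbors G v w, F y
      + ∑ y ∈ G.neighborFinset v ∩ G.neighborFinset w, F y
      + (if G.Adj v w then 1 else 0) * F w := by
  have h1 : (if G.Adj v w then 1 else 0) * F w =
      ∑ y ∈ (G.neighborFinset v).filter (fun y => y = w), F y := by
    simp [Finset.sum_filter]
  rw [h1, ← Finset.sum_union, ← Finset.sum_union]
  · refine Finset.sum_congr ?_ fun _ _ => rfl
    ext y
    simp only [Finset.mem_union, mem_privateNeighbors, Finset.mem_inter, Finset.mem_filter,
      SimpleGraph.mem_neighborFinset]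
    tauto
  · rw [Finset.disjoint_left]
    intro y
    simp only [Finset.mem_union, mem_privateNeighbors, Finset.mem_inter, Finset.mem_filter,
      SimpleGraph.mem_neighborFinset]
    rintro (h | h) ⟨_, rfl⟩
    · exact h.2.2 rfl
    · exact G.irrefl h.2
  · rw [Finset.disjoint_left]
    intro y
    simp only [mem_privateNeighbors, Finset.mem_inter, SimpleGraph.mem_neighborFinset]
    tauto

theorem degree_eq_card_privateNeighbors (v w : V) :
    (G.degree v : ℤ) = #(privateNeighbors G v w)
      + #(G.neighborFinset v ∩ G.neighborFinset w) + (if G.Adj v w then 1 else 0) := by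
  have := sum_neighborFinset_eq (G := G) (fun _ => 1) v w
  simpa using this

theorem nbrDegSum_sub_nbrDegSum (v w : V) :
    nbrDegSum G v - nbrDegSum G w =
      ∑ y ∈ privateNeighbors G v w, (G.degree y : ℤ)
        - ∑ y ∈ privateNeighbors G w v, (G.degree y : ℤ)
        + (if G.Adj v w then 1 else 0) * ((G.degree w : ℤ) - G.degree v) := by
  rw [nbrDegSum, nbrDegSum, sum_neighborFinset_eq _ v w, sum_neighborFinset_eq _ w v,
    Finset.inter_comm, G.adj_comm w v]
  ring

theorem full_shift_gain_nonneg {a b t m α δ SP ST : ℤ} (ht : 0 ≤ t) (hm : 0 ≤ m) (hα : 0 ≤ α)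
    (ha : a - b + t = m) (hSP : SP ≤ m * a) (hST : ST ≤ t * δ) (hδ : 2 * δ ≤ a + 3 * b) :
    0 ≤ 3 * (a + b) * t * (a - b + t) - 2 * t * (SP - ST + α * (b - a)) + 2 * t ^ 2 * α
      - 2 * (a - b + 2 * t) * ST := by
  have e1 := mul_le_mul_of_nonneg_left hSP ht
  have e2 := mul_le_mul_of_nonneg_left hST hm
  have e3 := mul_le_mul_of_nonneg_left hδ (mul_nonneg ht hm)
  have e4 := mul_nonneg (mul_nonneg ht hm) hα
  subst ha
  linarith

theorem partial_shift_gain_nonneg {a b d α SP ST : ℤ} (hb : 3 ≤ b) (hba : b ≤ a) (hα : 0 ≤ α)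
    (hda : d ≤ a) (h : a ≤ 3 * b ∨ d = 1) (hSP : SP ≤ (a - 1) * a) (hST : ST ≤ (b - 2) * d) :
    0 ≤ 3 * (a + b) * (b - 2) * (a - b + (b - 2))
      - 2 * (b - 2) * (SP - (ST + d) + α * (b - a)) + 2 * (b - 2) ^ 2 * α
      - 2 * (a - b + 2 * (b - 2)) * ST := by
  have hb2 : 0 ≤ b - 2 := by linarith
  have ha2 : 0 ≤ a - 2 := by linarith
  have e1 := mul_le_mul_of_nonneg_left hSP hb2
  have e2 := mul_le_mul_of_nonneg_left hST ha2
  have e3 := mul_nonneg (mul_nonneg hb2 ha2) hα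
  have e4 : 0 ≤ (a - 2) * (3 * a + 3 * b) - 2 * a * (a - 1) - 2 * (a - 3) * d := by
    rcases h with h | rfl
    · have := mul_le_mul_of_nonneg_left hda (by linarith : 0 ≤ a - 3)
      have := mul_nonneg (by linarith : 0 ≤ 3 * b - a) ha2
      linarith
    · have := mul_nonneg (by linarith : 0 ≤ a - 3) (by linarith : 0 ≤ b - 3)
      nlinarith
  have e5 := mul_nonneg hb2 e4
  linarith

theorem degree_sub_degree_add_card (v w : V) :
    (G.degree v : ℤ) - G.degree w + #(privateNeighbors G w v) = #(privateNeighbors G v w) := by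
  have hv := degree_eq_card_privateNeighbors (G := G) v w
  have hw := degree_eq_card_privateNeighbors (G := G) w v
  rw [Finset.inter_comm, G.adj_comm w v] at hw
  linarith

theorem improvedBy_full_shift (hG : G.Connected) (hmax : ∀ y, G.degree y ≤ G.degree v)
    (hvw : v ≠ w) (hk : ∃ k, G.Adj w k ∧ (k = v ∨ G.Adj v k))
    (hcard : #(privateNeighbors G w v) + 2 ≤ G.degree w) (hne : (privateNeighbors G w v).Nonempty)
    {δ : ℕ} (hδ : ∀ y ∈ privateNeighbors G w v, G.degree y ≤ δ)
    (hδ' : 2 * δ ≤ G.degree v + 3 * G.degree w) :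
    ImprovedBy G (shiftEdges G v w (privateNeighbors G w v)) := by
  have hT : ∀ y ∈ privateNeighbors G w v, G.Adj w y ∧ ¬ G.Adj v y ∧ y ≠ v :=
    fun y hy => mem_privateNeighbors.1 hy
  refine improvedBy_shiftEdges hG hmax hvw hT hne hk hcard ?_
  rw [sigmaIndex_shiftEdges hvw hT, nbrDegSum_sub_nbrDegSum v w]
  have hSP : ∑ y ∈ privateNeighbors G v w, (G.degree y : ℤ)
      ≤ #(privateNeighbors G v w) * G.degree v := sum_degree_le fun y _ => hmax y
  have := full_shift_gain_nonneg (Int.natCast_nonneg _) (Int.natCast_nonneg _)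
    (adj_ite_nonneg G v w) (degree_sub_degree_add_card v w) hSP (sum_degree_le hδ)
    (by exact_mod_cast hδ')
  linarith

theorem improvedBy_partial_shift (hG : G.Connected) (hmax : ∀ y, G.degree y ≤ G.degree v)
    (hvw : v ≠ w) (hk : ∃ k, G.Adj w k ∧ (k = v ∨ G.Adj v k)) (hw : 3 ≤ G.degree w)
    (hcard : #(privateNeighbors G w v) + 1 = G.degree w) {r : V}
    (hr : r ∈ privateNeighbors G w v)
    (hrmax : ∀ y ∈ privateNeighbors G w v, G.degree y ≤ G.degree r)
    (h : G.degree v ≤ 3 * G.degree w ∨ G.degree r = 1) :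
    ImprovedBy G (shiftEdges G v w ((privateNeighbors G w v).erase r)) := by
  have hT : ∀ y ∈ (privateNeighbors G w v).erase r, G.Adj w y ∧ ¬ G.Adj v y ∧ y ≠ v :=
    fun y hy => mem_privateNeighbors.1 (Finset.mem_of_mem_erase hy)
  have hcard' := Finset.card_erase_add_one hr
  refine improvedBy_shiftEdges hG hmax hvw hT (Finset.card_pos.1 (by omega)) hk (by omega) ?_
  rw [sigmaIndex_shiftEdges hvw hT, nbrDegSum_sub_nbrDegSum v w,
    ← Finset.sum_erase_add _ _ hr]
  have hP := degree_sub_degree_add_card (G := G) v w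
  have ht : (#((privateNeighbors G w v).erase r) : ℤ) = G.degree w - 2 := by omega
  have hSP : ∑ y ∈ privateNeighbors G v w, (G.degree y : ℤ)
      ≤ #(privateNeighbors G v w) * G.degree v := sum_degree_le fun y _ => hmax y
  have hST : ∑ y ∈ (privateNeighbors G w v).erase r, (G.degree y : ℤ)
      ≤ #((privateNeighbors G w v).erase r) * G.degree r :=
    sum_degree_le fun y hy => hrmax y (Finset.mem_of_mem_erase hy)
  rw [show (#(privateNeighbors G v w) : ℤ) = G.degree v - 1 by omega] at hSP
  rw [ht] at hST ⊢
  have := partial_shift_gain_nonneg (by exact_mod_cast hw) (by exact_mod_cast hmax w)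
    (adj_ite_nonneg G v w) (by exact_mod_cast hmax r) (by exact_mod_cast h) hSP hST
  linarith

theorem card_privateNeighbors_lt (hk : ∃ k, G.Adj w k ∧ (k = v ∨ G.Adj v k)) :
    #(privateNeighbors G w v) < G.degree w := by
  obtain ⟨k, hwk, hk⟩ := hk
  refine Finset.card_lt_card ((Finset.filter_ssubset).2 ⟨k, by simpa using hwk, by tauto⟩)

theorem exists_improvedBy_of_shift (hG : G.Connected) (hmax : ∀ y, G.degree y ≤ G.degree v)
    (hvw : v ≠ w) (hk : ∃ k, G.Adj w k ∧ (k = v ∨ G.Adj v k)) (hw : 3 ≤ G.degree w)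
    (hne : (privateNeighbors G w v).Nonempty)
    (h : G.degree v ≤ 3 * G.degree w ∨ ∀ y ∈ privateNeighbors G w v, G.degree y = 1) :
    ∃ G', ImprovedBy G G' := by
  have hlt := card_privateNeighbors_lt hk
  by_cases hc : #(privateNeighbors G w v) + 2 ≤ G.degree w
  · have hwv := hmax w
    rcases h with h | h
    · exact ⟨_, improvedBy_full_shift hG hmax hvw hk hc hne (fun y _ => hmax y) (by omega)⟩
    · exact ⟨_, improvedBy_full_shift hG hmax hvw hk hc hne (fun y hy => (h y hy).le) (by omega)⟩
  · obtain ⟨r, hr, hrmax⟩ := (privateNeighbors G w v).exists_max_image (fun y => G.degree y) hne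
    exact ⟨_, improvedBy_partial_shift hG hmax hvw hk hw (by omega) hr hrmax
      (h.imp_right fun h => h r hr)⟩

/-- If `v` has maximum degree and some vertex at distance two from `v` is not pendant, then `G` can
be improved. -/
theorem exists_improvedBy_of_two_le_degree (hG : G.Connected)
    (hmax : ∀ y, G.degree y ≤ G.degree v) {z : V} (hvz : G.Adj v z) (hzx : G.Adj z x)
    (hvx : ¬ G.Adj v x) (hxv : x ≠ v) (hx : 2 ≤ G.degree x) : ∃ G', ImprovedBy G G' := by
  by_cases hz : ∃ y, G.Adj v y ∧ G.Adj y x ∧ 3 ≤ G.degree y ∧ G.degree v ≤ 3 * G.degree y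
  · obtain ⟨y, hvy, hyx, hy3, hy⟩ := hz
    exact exists_improvedBy_of_shift hG hmax hvy.ne ⟨v, hvy.symm, Or.inl rfl⟩ hy3
      ⟨x, mem_privateNeighbors.2 ⟨hyx, hvx, hxv⟩⟩ (Or.inl hy)
  have hsmall : ∀ y, G.Adj v y → G.Adj y x → G.degree y ≤ 2 ∨ 3 * G.degree y < G.degree v := by
    intro y h1 h2
    by_contra! h
    exact hz ⟨y, h1, h2, by omega, by omega⟩
  have hdx : (G.degree x : ℤ) ≤ G.degree v := by exact_mod_cast hmax x
  have hx' : (2 : ℤ) ≤ G.degree x := by exact_mod_cast hx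
  by_cases h3 : 3 * G.degree x ≤ G.degree v
  · refine ⟨_, improvedBy_addEdge hG hmax hxv.symm hvx hx ?_⟩
    have h3' : 3 * (G.degree x : ℤ) ≤ G.degree v := by exact_mod_cast h3
    nlinarith [nbrDegSum_le hmax x]
  by_cases h2 : G.degree x = 2
  · refine ⟨_, improvedBy_addEdge hG hmax hxv.symm hvx hx ?_⟩
    have hzmem : z ∈ G.neighborFinset x := by simpa using hzx.symm
    have hS : nbrDegSum G x ≤ G.degree v + G.degree z := by
      rw [nbrDegSum, ← Finset.sum_erase_add _ _ hzmem]
      have := sum_degree_le (G := G) (s := (G.neighborFinset x).erase z) fun y _ => hmax y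
      rw [Finset.card_erase_of_mem hzmem, G.card_neighborFinset_eq_degree, h2] at this
      simpa using this
    have hz' : (G.degree z : ℤ) ≤ 2 ∨ 3 * (G.degree z : ℤ) < G.degree v := by
      exact_mod_cast hsmall z hvz hzx
    rw [h2]
    push_cast
    rcases hz' with h | h <;> nlinarith [sq_nonneg ((G.degree v : ℤ) - 3)]
  by_cases hne : (privateNeighbors G x v).Nonempty
  · exact exists_improvedBy_of_shift hG hmax hxv.symm ⟨z, hzx.symm, Or.inr hvz⟩ (by omega) hne
      (Or.inl (by omega))
  · refine ⟨_, improvedBy_addEdge hG hmax hxv.symm hvx hx ?_⟩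
    have hN : ∀ y ∈ G.neighborFinset x, G.degree y ≤ 2 ∨ 3 * G.degree y < G.degree v := by
      intro y hy
      rw [SimpleGraph.mem_neighborFinset] at hy
      refine hsmall y ?_ hy.symm
      by_contra hvy
      exact hne ⟨y, mem_privateNeighbors.2 ⟨hy, hvy, fun h => hvx (h ▸ hy.symm)⟩⟩
    by_cases h6 : 6 ≤ G.degree v
    · have := sum_degree_le (G := G) (s := G.neighborFinset x) (δ := G.degree v / 3)
        fun y hy => by have := hN y hy; omega
      rw [← nbrDegSum, G.card_neighborFinset_eq_degree] at this
      have h4 : 3 * ((G.degree v / 3 : ℕ) : ℤ) ≤ G.degree v := by omega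
      have h5 := mul_le_mul_of_nonneg_left h4 (by linarith : (0 : ℤ) ≤ G.degree x)
      nlinarith [sq_nonneg (3 * (G.degree v : ℤ) - 4 * G.degree x)]
    · have := sum_degree_le (G := G) (s := G.neighborFinset x) (δ := 2)
        fun y hy => by have := hN y hy; omega
      rw [← nbrDegSum, G.card_neighborFinset_eq_degree] at this
      push_cast at this
      nlinarith [sq_nonneg ((G.degree v : ℤ) - G.degree x)]

/-- A pendant path `v, w, x` is turned into a pendant edge `vx` and an edge `wu`, where `u` is
another neighbour of `v` that is not pendant. -/
theorem improvedBy_of_pendant_path (hG : G.Connected) (hmax : ∀ y, G.degree y ≤ G.degree v)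
    {u : V} (hvw : G.Adj v w) (hwx : G.Adj w x) (hvx : ¬ G.Adj v x) (hxv : x ≠ v)
    (hw : G.degree w = 2) (hx : G.degree x = 1) (hvu : G.Adj v u) (huw : u ≠ w)
    (hu : 2 ≤ G.degree u) : ImprovedBy G (addEdge (shiftEdges G v w {x}) w u) := by
  have hNw : G.neighborFinset w = {v, x} := by
    refine (Finset.eq_of_subset_of_card_le ?_ ?_).symm
    · simp [Finset.insert_subset_iff, hvw.symm, hwx]
    · rw [G.card_neighborFinset_eq_degree, hw, Finset.card_pair hxv.symm]
  have hux : u ≠ x := fun h => hvx (h ▸ hvu)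
  have hadj_w : ∀ y, G.Adj w y ↔ y = v ∨ y = x := fun y => by
    rw [← SimpleGraph.mem_neighborFinset, hNw]; simp
  have hT : ∀ y ∈ ({x} : Finset V), G.Adj w y ∧ ¬ G.Adj v y ∧ y ≠ v := by
    simp [hwx, hvx, hxv]
  set G₁ := shiftEdges G v w {x} with hG₁
  have hd₁ : ∀ y, (G₁.degree y : ℤ) = _ := degree_shiftEdges hvw.ne hT
  have hnadj : ¬ G₁.Adj w u := by
    rw [hG₁, shiftEdges_adj hT, hadj_w]
    have := hvu.ne'
    have := hvw.ne'
    have := hwx.ne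
    simp [*]
  have hd₂ := degree_addEdge huw.symm hnadj
  have hwv' : w ≠ v := hvw.ne'
  have huv' : u ≠ v := hvu.ne'
  have hv₁ : (G₁.degree v : ℤ) = G.degree v + 1 := by simp [hd₁, hwv'.symm]
  have hw₁ : (G₁.degree w : ℤ) = 1 := by simp [hd₁, hwv', hw]
  have hu₁ : (G₁.degree u : ℤ) = G.degree u := by simp [hd₁, huv', huw]
  have hdu : (G.degree u : ℤ) ≤ G.degree v := by exact_mod_cast hmax u
  have hu' : (2 : ℤ) ≤ G.degree u := by exact_mod_cast hu
  have hSw : nbrDegSum G w = G.degree v + 1 := by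
    rw [nbrDegSum, hNw, Finset.sum_pair hxv.symm, hx]
    simp
  have hSv : nbrDegSum G v ≤ (G.degree v - 1) * G.degree v + 2 := by
    have hmem : w ∈ G.neighborFinset v := by simpa using hvw
    have := sum_degree_le (G := G) (s := (G.neighborFinset v).erase w) fun y _ => hmax y
    rw [Finset.card_erase_of_mem hmem, G.card_neighborFinset_eq_degree,
      Nat.cast_sub (by omega)] at this
    rw [nbrDegSum, ← Finset.sum_erase_add _ _ hmem, hw]
    push_cast at this ⊢
    linarith
  have hSw₁ : nbrDegSum G₁ w = G.degree v + 1 := by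
    have : G₁.neighborFinset w = {v} := by
      ext y
      rw [SimpleGraph.mem_neighborFinset, hG₁, shiftEdges_adj hT, hadj_w, Finset.mem_singleton,
        Finset.mem_singleton, Finset.mem_singleton]
      have := hwx.ne
      grind
    rw [nbrDegSum, this, Finset.sum_singleton, hv₁]
  have hSu₁ : nbrDegSum G₁ u ≤ G.degree u * G.degree v + 1 := by
    have hN : G₁.neighborFinset u = G.neighborFinset u := by
      ext y
      rw [SimpleGraph.mem_neighborFinset, SimpleGraph.mem_neighborFinset, hG₁, shiftEdges_adj hT,
        Finset.mem_singleton, Finset.mem_singleton]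
      tauto
    have hle : ∀ y ∈ G.neighborFinset u,
        (G₁.degree y : ℤ) ≤ G.degree y + (if y = v then 1 else 0) := by
      intro y _
      rw [hd₁]
      simp only [Finset.card_singleton, Pi.single_apply]
      split_ifs <;> simp
    have h1 := Finset.sum_le_sum hle
    rw [Finset.sum_add_distrib, Finset.sum_ite_eq' (G.neighborFinset u) v,
      if_pos (by simpa using hvu.symm)] at h1
    have h2 := nbrDegSum_le hmax u
    rw [nbrDegSum] at h2
    rw [nbrDegSum, hN]
    linarith
  refine improvedBy_of_degree (v := v)
    (connected_addEdge (connected_shiftEdges hG hT ⟨v, hvw.symm, Or.inl rfl⟩) huw.symm) hmax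
    (fun y => ?_) ?_ ?_
  · have h1 := hd₁ y
    have h2 := hd₂ y
    simp only [Pi.single_apply, Finset.card_singleton] at h1 h2
    by_cases hyv : y = v
    · subst hyv
      simp only [hwv'.symm, huv'.symm, if_false] at h2
      omega
    by_cases hyw : y = w
    · subst hyw
      simp only [huw.symm, if_true, if_false] at h2
      omega
    by_cases hyu : y = u
    · subst hyu
      simp only [huw, if_true, if_false] at h2
      omega
    simp only [hyv, hyw, hyu, if_false] at h1 h2
    omega
  · have h2 := hd₂ v
    simp only [Pi.single_apply, hwv'.symm, huv'.symm, if_false] at h2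
    omega
  · rw [sigmaIndex_addEdge huw.symm hnadj, hSw₁, hw₁, hu₁, hG₁, sigmaIndex_shiftEdges hvw.ne hT,
      ← hG₁, hSw, hw, if_pos hvw, Finset.sum_singleton, Finset.card_singleton, hx]
    push_cast
    nlinarith [sq_nonneg ((G.degree v : ℤ) - G.degree u)]

theorem one_le_degree_of_adj {y z : V} (h : G.Adj y z) : 1 ≤ G.degree y :=
  (G.degree_pos_iff_exists_adj y).2 ⟨z, h⟩

/-- If all vertices at distance two from `v` are pendant, then so are all vertices outside the
closed neighbourhood of `v`. -/
theorem degree_eq_one_of_not_adj (hG : G.Connected)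
    (h : ∀ x z, G.Adj v z → G.Adj z x → ¬ G.Adj v x → x ≠ v → G.degree x = 1) {u : V}
    (huv : u ≠ v) (hvu : ¬ G.Adj v u) : G.degree u = 1 := by
  let S : Set V := {y | y = v ∨ G.Adj v y ∨ (G.degree y = 1 ∧ ∃ z, G.Adj v z ∧ G.Adj z y)}
  by_cases hS : u ∈ S
  · rcases hS with hS | hS | hS
    · exact absurd hS huv
    · exact absurd hS hvu
    · exact hS.1
  obtain ⟨p⟩ := hG.preconnected v u
  obtain ⟨d, -, hd1, hd2⟩ := p.exists_boundary_dart S (Or.inl rfl) hS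
  exfalso
  apply hd2
  by_cases h1 : d.snd = v
  · exact Or.inl h1
  by_cases h2 : G.Adj v d.snd
  · exact Or.inr (Or.inl h2)
  have hadj := d.adj
  rcases hd1 with hd1 | hd1 | ⟨hd1, z, hvz, hz⟩
  · exact absurd (hd1 ▸ hadj) h2
  · exact Or.inr (Or.inr ⟨h _ _ hd1 hadj h2 h1, _, hd1, hadj⟩)
  · have := (SimpleGraph.degree_eq_one_iff_existsUnique_adj.1 hd1).unique hadj hz.symm
    exact absurd (this ▸ hvz) h2

theorem exists_improvedBy (hG : G.Connected) (hp : pendantCount G + 3 ≤ Fintype.card V)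
    (hlt : maxDeg G + 1 < Fintype.card V) : ∃ G', ImprovedBy G G' := by
  have := hG.nonempty
  obtain ⟨v, hv⟩ := G.exists_maximal_degree_vertex
  have hmax : ∀ y, G.degree y ≤ G.degree v := fun y => hv ▸ G.degree_le_maxDegree y
  have hlt' : G.degree v + 1 < Fintype.card V := hv ▸ hlt
  obtain ⟨y, hy⟩ : ∃ y, y ∉ insert v (G.neighborFinset v) := by
    by_contra! h
    have := Finset.card_le_card (fun y _ => h y : univ ⊆ insert v (G.neighborFinset v))
    have h2 := Finset.card_insert_le v (G.neighborFinset v)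
    rw [G.card_neighborFinset_eq_degree] at h2
    rw [Finset.card_univ] at this
    omega
  obtain ⟨p⟩ := hG.preconnected v y
  obtain ⟨d, -, hd1, hd2⟩ := p.exists_boundary_dart (insert v (G.neighborFinset v) : Finset V)
    (by simp) (by simpa using hy)
  simp only [Finset.coe_insert, SimpleGraph.coe_neighborFinset, Set.mem_insert_iff,
    SimpleGraph.mem_neighborSet, not_or] at hd1 hd2
  obtain ⟨hxv, hvx⟩ := hd2
  have hzx := d.adj
  have hvz : G.Adj v d.fst := by
    rcases hd1 with h | h
    · exact absurd (h ▸ hzx) hvx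
    · exact h
  by_cases hA : ∃ x z, G.Adj v z ∧ G.Adj z x ∧ ¬ G.Adj v x ∧ x ≠ v ∧ 2 ≤ G.degree x
  · obtain ⟨x, z, h1, h2, h3, h4, h5⟩ := hA
    exact exists_improvedBy_of_two_le_degree hG hmax h1 h2 h3 h4 h5
  have hpend : ∀ x z, G.Adj v z → G.Adj z x → ¬ G.Adj v x → x ≠ v → G.degree x = 1 := by
    intro x z h1 h2 h3 h4
    have := one_le_degree_of_adj h2.symm
    by_contra h5
    exact hA ⟨x, z, h1, h2, h3, h4, by omega⟩
  generalize d.fst = z at *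
  generalize d.snd = x at *
  have hx := hpend x z hvz hzx hvx hxv
  by_cases hz3 : 3 ≤ G.degree z
  · refine exists_improvedBy_of_shift hG hmax hvz.ne ⟨v, hvz.symm, Or.inl rfl⟩ hz3
      ⟨x, mem_privateNeighbors.2 ⟨hzx, hvx, hxv⟩⟩ (Or.inr fun y hy => ?_)
    obtain ⟨h1, h2, h3⟩ := mem_privateNeighbors.1 hy
    exact hpend y z hvz h1 h2 h3
  have hz2 : G.degree z = 2 := by
    have := Finset.card_le_card (show {v, x} ⊆ G.neighborFinset z by
      simp [Finset.insert_subset_iff, hvz.symm, hzx])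
    rw [Finset.card_pair (Ne.symm hxv), G.card_neighborFinset_eq_degree] at this
    omega
  obtain ⟨u, hu, huv, huz⟩ : ∃ u, G.degree u ≠ 1 ∧ u ≠ v ∧ u ≠ z := by
    by_contra! h
    have h1 : univ ⊆ univ.filter (fun w => G.degree w = 1) ∪ {v, z} := by
      intro u _
      have := h u
      simp only [Finset.mem_union, Finset.mem_filter, Finset.mem_univ, true_and,
        Finset.mem_insert, Finset.mem_singleton]
      tauto
    have h2 := (Finset.card_le_card h1).trans (Finset.card_union_le _ _)
    have h3 := Finset.card_le_two (a := v) (b := z)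
    have h4 : pendantCount G = #(univ.filter (fun w => G.degree w = 1)) := rfl
    rw [Finset.card_univ] at h2
    omega
  have hvu : G.Adj v u := by
    by_contra hvu
    exact hu (degree_eq_one_of_not_adj hG hpend huv hvu)
  have := one_le_degree_of_adj hvu.symm
  exact ⟨_, improvedBy_of_pendant_path hG hmax hvz hzx hvx hxv hz2 hx hvu huz (by omega)⟩

theorem exists_max_sigmaIndex_of_exists {p : ℕ} (hp : p + 3 ≤ Fintype.card V)
    (hex : ∃ G : SimpleGraph V, G.Connected ∧ pendantCount G = p) :
    ∃ G : SimpleGraph V, G.Connected ∧ pendantCount G = p ∧ maxDeg G = Fintype.card V - 1 ∧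
      ∀ H : SimpleGraph V, H.Connected → pendantCount H = p → sigmaIndex H ≤ sigmaIndex G := by
  obtain ⟨G, ⟨hG, hGp⟩, hmax⟩ := Set.exists_max_image
    {G : SimpleGraph V | G.Connected ∧ pendantCount G = p}
    (fun G => toLex (sigmaIndex G, maxDeg G)) (Set.toFinite _) hex
  simp only [Prod.Lex.toLex_le_toLex] at hmax
  refine ⟨G, hG, hGp, ?_, fun H hH hHp => ?_⟩
  · by_contra hne
    have := hG.nonempty
    have hle : maxDeg G < Fintype.card V := G.maxDegree_lt_card_verts
    obtain ⟨G', hG', hp', hdeg, hσ⟩ := exists_improvedBy hG (by omega) (by omega)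
    rcases hmax G' ⟨hG', hp'.trans hGp⟩ with h | h <;> omega
  · rcases hmax H ⟨hH, hHp⟩ with h | h
    · exact h.le
    · exact h.1.le

theorem pendantCount_eq_card {s : Finset V} (h : ∀ y, (∃! z, G.Adj y z) ↔ y ∈ s) :
    pendantCount G = #s := by
  simp only [pendantCount, SimpleGraph.degree_eq_one_iff_existsUnique_adj, h,
    Finset.filter_univ_mem]

end

theorem exists_connected_pendantCount_eq {n p : ℕ} (hpn : p + 3 ≤ n) :
    ∃ G : SimpleGraph (Fin n), G.Connected ∧ pendantCount G = p := by
  let G : SimpleGraph (Fin n) :=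
    SimpleGraph.fromRel fun i j => i.val = 0 ∨ (p < i.val ∧ p < j.val)
  have hadj : ∀ i j, G.Adj i j ↔ i.val ≠ j.val ∧
      (i.val = 0 ∨ j.val = 0 ∨ (p < i.val ∧ p < j.val)) := by
    intro i j
    simp only [G, SimpleGraph.fromRel_adj, ne_eq, Fin.ext_iff]
    tauto
  let o : Fin n := ⟨0, by omega⟩
  refine ⟨G, ?_, ?_⟩
  · have hr : ∀ i, G.Reachable o i := fun i => by
      by_cases h : i = o
      · rw [h]
      · exact SimpleGraph.Adj.reachable ((hadj o i).2 ⟨fun h' => h (Fin.ext h'.symm), Or.inl rfl⟩)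
    have : Nonempty (Fin n) := ⟨o⟩
    exact ⟨fun i j => (hr i).symm.trans (hr j)⟩
  · rw [pendantCount_eq_card (s := Finset.Icc ⟨1, by omega⟩ ⟨p, by omega⟩)]
    · simp
    · intro i
      simp only [hadj, Finset.mem_Icc, Fin.le_def]
      constructor
      · intro h
        by_contra hi
        have hi' : i.val = 0 ∨ p < i.val := by omega
        obtain ⟨j, k, hj, hk, hjk⟩ : ∃ j k : ℕ, ∃ (hj : j < n) (hk : k < n), j ≠ k ∧
            (i.val ≠ j ∧ (i.val = 0 ∨ j = 0 ∨ (p < i.val ∧ p < j))) ∧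
            (i.val ≠ k ∧ (i.val = 0 ∨ k = 0 ∨ (p < i.val ∧ p < k))) := by
          rcases hi' with hi' | hi'
          · exact ⟨1, 2, by omega, by omega, by omega⟩
          · by_cases h1 : i.val = p + 1
            · exact ⟨0, p + 2, by omega, by omega, by omega⟩
            · exact ⟨0, p + 1, by omega, by omega, by omega⟩
        have := h.unique (y₁ := ⟨j, hj⟩) (y₂ := ⟨k, hk⟩) hjk.2.1 hjk.2.2
        exact hjk.1 (Fin.ext_iff.1 this)
      · rintro ⟨h1, h2⟩
        refine ⟨o, ⟨by simp [o]; omega, Or.inr (Or.inl rfl)⟩, fun j hj => Fin.ext ?_⟩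
        simp only [o]
        omega

/-- for `n ≥ 4` and `1 ≤ p ≤ n − 3`, the maximum of the sigma index over
all connected graphs on `n` vertices with exactly `p` pendant vertices is attained by a
graph with maximum degree `n − 1`. -/
theorem sigma_max_pendant_attained_by_max_degree (n p : ℕ)
    (hn : 4 ≤ n) (hp1 : 1 ≤ p) (hpn : p ≤ n - 3) :
    ∃ G : SimpleGraph (Fin n), G.Connected ∧ pendantCount G = p ∧ maxDeg G = n - 1 ∧
      ∀ H : SimpleGraph (Fin n), H.Connected → pendantCount H = p →
        sigmaIndex H ≤ sigmaIndex G := by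
  have hpn' : p + 3 ≤ n := by omega
  simpa using exists_max_sigmaIndex_of_exists (V := Fin n) (by simpa using hpn')
    (exists_connected_pendantCount_eq hpn')
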